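/- For every nonzero u ∈ ℝ^d, the scaled sign operator 𝒞(u) = (‖u‖_1 / d) · sign(u) (sign acting coordinatewise, sign(0) = 0) satisfies ‖𝒞(u) − u‖_2² ≤ ‖u‖_2² − ‖u‖_1²/d = (1 − ‖u‖_1²/(d‖u‖_2²)) ‖u‖_2², with equality whenever all coordinates of u are nonzero. Consequently, by the Cauchy–Schwarz inequality ‖u‖_1² ≥ ‖u‖_2², the bound ‖𝒞(u) − u‖_2² ≤ (1 − 1/d) ‖u‖_2² holds for all u ∈ ℝ^d, so 𝒞 is a (1/d)-approximate compressor. -/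

import Mathlib

open Finset

/-- The scaled sign compressor `𝒞(u) = (‖u‖₁/d)·sign(u)` on `ℝ^d`. -/
noncomputable def scaledSign (d : ℕ) (u : Fin d → ℝ) : Fin d → ℝ :=
  fun j => ((∑ k, |u k|) / d) * Real.sign (u j)

theorem sq_mul_sign_sub (c x : ℝ) (hx : x ≠ 0) :
    (c * Real.sign x - x) ^ 2 = c ^ 2 - 2 * c * |x| + x ^ 2 := by
  rcases lt_or_gt_of_ne hx with h | h
  · rw [Real.sign_of_neg h, abs_of_neg h]
    ring
  · rw [Real.sign_of_pos h, abs_of_pos h]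
    ring

theorem sq_mul_sign_sub_le (c x : ℝ) :
    (c * Real.sign x - x) ^ 2 ≤ c ^ 2 - 2 * c * |x| + x ^ 2 := by
  rcases eq_or_ne x 0 with rfl | hx
  · simp [sq_nonneg]
  · exact (sq_mul_sign_sub c x hx).le

theorem sum_mean_abs_quadratic (d : ℕ) (hd : 0 < d) (u : Fin d → ℝ) :
    ∑ j, (((∑ k, |u k|) / d) ^ 2 - 2 * ((∑ k, |u k|) / d) * |u j| + (u j) ^ 2)
      = (∑ j, (u j) ^ 2) - (∑ j, |u j|) ^ 2 / d := by
  have hd' : (d : ℝ) ≠ 0 := by positivity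
  rw [sum_add_distrib, sum_sub_distrib, ← mul_sum]
  simp only [sum_const, card_univ, Fintype.card_fin, nsmul_eq_mul]
  field_simp
  ring

theorem sum_sq_scaledSign_sub_le (d : ℕ) (hd : 0 < d) (u : Fin d → ℝ) :
    ∑ j, (scaledSign d u j - u j) ^ 2 ≤ (∑ j, (u j) ^ 2) - (∑ j, |u j|) ^ 2 / d := by
  rw [← sum_mean_abs_quadratic d hd u]
  exact sum_le_sum fun j _ => sq_mul_sign_sub_le _ _

theorem sum_sq_le_sq_sum_abs {ι : Type*} (s : Finset ι) (u : ι → ℝ) :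
    ∑ j ∈ s, (u j) ^ 2 ≤ (∑ j ∈ s, |u j|) ^ 2 := by
  simpa only [sq_abs] using sum_sq_le_sq_sum_of_nonneg (s := s) fun j _ => abs_nonneg (u j)

/-- **Scaled sign operator is a (1/d)-approximate compressor.**
For nonzero `u`, `‖𝒞(u) − u‖₂² ≤ ‖u‖₂² − ‖u‖₁²/d = (1 − ‖u‖₁²/(d‖u‖₂²))‖u‖₂²`, with
equality when all coordinates of `u` are nonzero; by Cauchy–Schwarz `‖u‖₁² ≥ ‖u‖₂²`,
and hence `‖𝒞(u) − u‖₂² ≤ (1 − 1/d)‖u‖₂²` for all `u`. -/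
theorem scaledSign_approx_compressor (d : ℕ) (hd : 0 < d) :
    (∀ u : Fin d → ℝ, u ≠ 0 →
        ∑ j, (scaledSign d u j - u j)^2 ≤ (∑ j, (u j)^2) - (∑ j, |u j|)^2 / d)
    ∧ (∀ u : Fin d → ℝ, u ≠ 0 →
        (∑ j, (u j)^2) - (∑ j, |u j|)^2 / d
          = (1 - (∑ j, |u j|)^2 / (d * ∑ j, (u j)^2)) * ∑ j, (u j)^2)
    ∧ (∀ u : Fin d → ℝ, (∀ j, u j ≠ 0) →
        ∑ j, (scaledSign d u j - u j)^2 = (∑ j, (u j)^2) - (∑ j, |u j|)^2 / d)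
    ∧ (∀ u : Fin d → ℝ, (∑ j, (u j)^2) ≤ (∑ j, |u j|)^2)
    ∧ (∀ u : Fin d → ℝ,
        ∑ j, (scaledSign d u j - u j)^2 ≤ (1 - 1/d) * ∑ j, (u j)^2) := by
  have hd' : (0 : ℝ) < d := by exact_mod_cast hd
  refine ⟨fun u _ => sum_sq_scaledSign_sub_le d hd u, fun u hu => ?_, fun u hu => ?_,
    sum_sq_le_sq_sum_abs univ, fun u => (sum_sq_scaledSign_sub_le d hd u).trans ?_⟩
  · have hne : ∑ j, (u j) ^ 2 ≠ 0 := by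
      intro h
      rw [sum_eq_zero_iff_of_nonneg fun j _ => sq_nonneg (u j)] at h
      exact hu (funext fun j => pow_eq_zero_iff two_ne_zero |>.mp (h j (mem_univ j)))
    field_simp
  · rw [← sum_mean_abs_quadratic d hd u]
    exact sum_congr rfl fun j _ => sq_mul_sign_sub _ _ (hu j)
  · rw [sub_mul, one_mul, one_div_mul_eq_div]
    gcongr
    exact sum_sq_le_sq_sum_abs univ u
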